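/- In the independent-set reduction graph G', the maximum over all vertex subsets S' of the influence difference δ(S') = |reach_{E'∪E''}(S')| − |reach_{E'}(S')| equals the maximum size of an independent set in G. -/

import Mathlib

/-- Vertices reachable from `S` via directed edges given by relation `E`. -/
def reach {V : Type*} (E : V → V → Prop) (S : Set V) : Set V :=
  {v | ∃ s ∈ S, Relation.ReflTransGen E s v}

/-- Edges E' of the reduction graph: (v'_i, v''_j) whenever {v_i, v_j} is an edge of G.
`Sum.inl` is the copy V', `Sum.inr` the copy V''. -/
def E1 {V : Type*} (Adj : V → V → Prop) : (V ⊕ V) → (V ⊕ V) → Prop :=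
  fun a b => ∃ i j, Adj i j ∧ a = Sum.inl i ∧ b = Sum.inr j

/-- Edges E'' of the reduction graph: (v'_i, v''_i) for every vertex v_i of G. -/
def E2 {V : Type*} : (V ⊕ V) → (V ⊕ V) → Prop :=
  fun a b => ∃ i, a = Sum.inl i ∧ b = Sum.inr i

/-- Influence difference δ(S) = |reach_{E'∪E''}(S)| − |reach_{E'}(S)|. -/
noncomputable def delta {V : Type*} [Fintype V] (Adj : V → V → Prop) (S : Set (V ⊕ V)) : ℤ :=
  ((reach (fun a b => E1 Adj a b ∨ E2 a b) S).ncard : ℤ) - ((reach (E1 Adj) S).ncard : ℤ)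

theorem reach_bipartite {V : Type*} (R : V → V → Prop) (S : Set (V ⊕ V)) :
    reach (fun a b => ∃ i j, R i j ∧ a = Sum.inl i ∧ b = Sum.inr j) S =
      S ∪ Sum.inr '' {j | ∃ i, Sum.inl i ∈ S ∧ R i j} := by
  ext v
  constructor
  · rintro ⟨s, hs, h⟩
    induction h with
    | refl => exact Or.inl hs
    | tail _ hbc ih =>
      obtain ⟨i, j, hR, rfl, rfl⟩ := hbc
      rcases ih with ih | ⟨k, _, hk⟩
      · exact Or.inr ⟨j, ⟨i, ih, hR⟩, rfl⟩
      · simp at hk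
  · rintro (h | ⟨j, ⟨i, hi, hR⟩, rfl⟩)
    · exact ⟨v, h, .refl⟩
    · exact ⟨_, hi, .single ⟨i, j, hR, rfl, rfl⟩⟩

theorem delta_eq_ncard {V : Type*} [Fintype V] (Adj : V → V → Prop) (S : Set (V ⊕ V)) :
    delta Adj S = ({i | Sum.inl i ∈ S ∧ Sum.inr i ∉ S ∧
      ∀ j, Sum.inl j ∈ S → ¬ Adj j i}.ncard : ℤ) := by
  have h1 : reach (E1 Adj) S = S ∪ Sum.inr '' {j | ∃ i, Sum.inl i ∈ S ∧ Adj i j} :=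
    reach_bipartite Adj S
  have h2 : reach (fun a b => E1 Adj a b ∨ E2 a b) S =
      S ∪ Sum.inr '' {j | ∃ i, Sum.inl i ∈ S ∧ (Adj i j ∨ i = j)} := by
    rw [← reach_bipartite (fun i j => Adj i j ∨ i = j) S]
    congr 1
    ext a b
    simp only [E1, E2]
    constructor
    · rintro (⟨i, j, h, ha, hb⟩ | ⟨i, ha, hb⟩)
      · exact ⟨i, j, .inl h, ha, hb⟩
      · exact ⟨i, i, .inr rfl, ha, hb⟩
    · rintro ⟨i, j, h | rfl, ha, hb⟩
      · exact .inl ⟨i, j, h, ha, hb⟩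
      · exact .inr ⟨i, ha, hb⟩
  have hsub : reach (E1 Adj) S ⊆ reach (fun a b => E1 Adj a b ∨ E2 a b) S := by
    rw [h1, h2]
    gcongr
    exact Or.inl
  rw [delta, ← Set.ncard_sdiff_add_ncard_of_subset hsub (Set.toFinite _), Nat.cast_add,
    add_sub_cancel_right, ← Set.ncard_image_of_injective {i | _} (Sum.inr_injective (α := V)), h1, h2]
  congr 2
  ext (v | v)
  · simp
  · simp
    grind

theorem max_delta_eq_max_independent {V : Type*} [Fintype V] (Adj : V → V → Prop)
    (hsym : ∀ i j, Adj i j → Adj j i) (m : ℤ) :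
    IsGreatest {x : ℤ | ∃ S' : Set (V ⊕ V), x = delta Adj S'} m ↔
      IsGreatest {x : ℤ | ∃ I : Set V, (∀ i ∈ I, ∀ j ∈ I, ¬ Adj i j) ∧ x = (I.ncard : ℤ)} m := by
  suffices h : {x : ℤ | ∃ S' : Set (V ⊕ V), x = delta Adj S'} =
      {x : ℤ | ∃ I : Set V, (∀ i ∈ I, ∀ j ∈ I, ¬ Adj i j) ∧ x = (I.ncard : ℤ)} by rw [h]
  ext x
  constructor
  · rintro ⟨S, rfl⟩
    exact ⟨_, fun i hi j hj => hj.2.2 i hi.1, delta_eq_ncard Adj S⟩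
  · rintro ⟨I, hI, rfl⟩
    refine ⟨Sum.inl '' I, ?_⟩
    rw [delta_eq_ncard]
    congr 2
    ext i
    simp
    grind
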